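/- Let r > 0 and let μ be a Borel probability measure on ℝ supported in [−r, ∞) such that c := ∫_{(0,∞)} v dμ(v) = ∫_{[−r,0)} (−u) dμ(u) lies in (0, ∞). For ε > 0 set A_ε := (−ε, 0) × (0, ∞) and B_ε := [−r, 0) × (0, ε). Then (1/c) ∬_{A_ε ∪ B_ε} (v − u) dμ(u) dμ(v) ≤ μ([−ε, ε]) + 2ε/c. -/

import Mathlib

open MeasureTheory

theorem integrableOn_of_setIntegral_ne_zero {α : Type*} [MeasurableSpace α] {μ : Measure α}
    {f : α → ℝ} {s : Set α} (h : ∫ x in s, f x ∂μ ≠ 0) : IntegrableOn f s μ := by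
  by_contra hf
  exact h (integral_undef hf)

theorem integrableOn_snd_sub_fst_prod {μ : Measure ℝ} [IsFiniteMeasure μ] {s t : Set ℝ}
    (hs : IntegrableOn (fun x => x) s μ) (ht : IntegrableOn (fun x => x) t μ) :
    IntegrableOn (fun p : ℝ × ℝ => p.2 - p.1) (s ×ˢ t) (μ.prod μ) := by
  rw [IntegrableOn, ← Measure.prod_restrict]
  exact (Integrable.comp_snd ht _).sub (Integrable.comp_fst hs _)

theorem setIntegral_prod_snd_sub_fst {μ : Measure ℝ} [IsFiniteMeasure μ] {s t : Set ℝ}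
    (hs : IntegrableOn (fun x => x) s μ) (ht : IntegrableOn (fun x => x) t μ) :
    ∫ p in s ×ˢ t, (p.2 - p.1) ∂(μ.prod μ) =
      μ.real s * ∫ v in t, v ∂μ + μ.real t * ∫ u in s, -u ∂μ := by
  rw [← Measure.prod_restrict,
    integral_sub (Integrable.comp_snd ht _) (Integrable.comp_fst hs _),
    integral_fun_snd (fun x : ℝ => x), integral_fun_fst (fun x : ℝ => x), integral_neg]
  simp only [measureReal_restrict_apply_univ, smul_eq_mul]
  ring

theorem setIntegral_union_le_add {α : Type*} [MeasurableSpace α] {μ : Measure α} {f : α → ℝ}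
    {s t : Set α} (hs : MeasurableSet s) (ht : MeasurableSet t)
    (hfs : IntegrableOn f s μ) (hft : IntegrableOn f t μ)
    (hf : ∀ x ∈ s ∪ t, 0 ≤ f x) :
    ∫ x in s ∪ t, f x ∂μ ≤ ∫ x in s, f x ∂μ + ∫ x in t, f x ∂μ := by
  rw [← integral_add_measure hfs hft]
  refine integral_mono_measure (Measure.restrict_union_le s t) ?_ (Integrable.add_measure hfs hft)
  rw [Filter.EventuallyLE, ae_add_measure_iff]
  exact ⟨ae_restrict_of_forall_mem hs fun x hx => hf x (.inl hx),
    ae_restrict_of_forall_mem ht fun x hx => hf x (.inr hx)⟩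

theorem setIntegral_le_of_forall_le {α : Type*} [MeasurableSpace α] {μ : Measure α}
    [IsProbabilityMeasure μ] {f : α → ℝ} {s : Set α} {C : ℝ} (hs : MeasurableSet s)
    (hC : 0 ≤ C) (hf : IntegrableOn f s μ) (h : ∀ x ∈ s, f x ≤ C) :
    ∫ x in s, f x ∂μ ≤ C := by
  calc ∫ x in s, f x ∂μ ≤ ∫ _ in s, C ∂μ :=
        setIntegral_mono_on hf (integrable_const C) hs h
    _ = μ.real s * C := by simp
    _ ≤ C := mul_le_of_le_one_left hC measureReal_le_one

theorem integrableOn_id_of_subset_Icc {μ : Measure ℝ} [IsFiniteMeasure μ] {s : Set ℝ} {a b : ℝ}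
    (hs : s ⊆ Set.Icc a b) : IntegrableOn (fun x => x) s μ :=
  (continuousOn_id.integrableOn_compact isCompact_Icc).mono_set hs

/-- let `μ` be a Borel probability measure on `ℝ` supported in
`[−r, ∞)`, with `c = ∫_{(0,∞)} v dμ = ∫_{[−r,0)} (−u) dμ ∈ (0,∞)`. For `ε > 0`,
with `A_ε = (−ε,0) × (0,∞)` and `B_ε = [−r,0) × (0,ε)`,
`(1/c) ∬_{A_ε ∪ B_ε} (v − u) dμ(u)dμ(v) ≤ μ([−ε,ε]) + 2ε/c`. -/
theorem stmt_11 (r : ℝ) (hr : 0 < r) (μ : Measure ℝ) [IsProbabilityMeasure μ]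
    (hsupp : μ (Set.Iio (-r)) = 0)
    (c : ℝ)
    (hc_pos : 0 < c)
    (hc_plus : c = ∫ v in Set.Ioi (0 : ℝ), v ∂μ)
    (hc_minus : c = ∫ u in Set.Ico (-r) (0 : ℝ), -u ∂μ)
    (ε : ℝ) (hε : 0 < ε) :
    (1 / c) * ∫ p in (Set.Ioo (-ε) 0 ×ˢ Set.Ioi (0 : ℝ)) ∪
        (Set.Ico (-r) 0 ×ˢ Set.Ioo (0 : ℝ) ε), (p.2 - p.1) ∂(μ.prod μ)
      ≤ (μ (Set.Icc (-ε) ε)).toReal + 2 * ε / c := by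
  have hP := integrableOn_of_setIntegral_ne_zero (hc_plus ▸ hc_pos.ne')
  have hN : IntegrableOn (fun x => x) (Set.Ico (-r) 0) μ :=
    integrableOn_id_of_subset_Icc Set.Ico_subset_Icc_self
  have hU : IntegrableOn (fun x => x) (Set.Ioo (-ε) 0) μ :=
    integrableOn_id_of_subset_Icc Set.Ioo_subset_Icc_self
  have hV : IntegrableOn (fun x => x) (Set.Ioo 0 ε) μ :=
    integrableOn_id_of_subset_Icc Set.Ioo_subset_Icc_self
  have hunion := setIntegral_union_le_add (measurableSet_Ioo.prod measurableSet_Ioi)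
    (measurableSet_Ico.prod measurableSet_Ioo) (integrableOn_snd_sub_fst_prod hU hP)
    (integrableOn_snd_sub_fst_prod hN hV) (by
      rintro ⟨u, v⟩ (⟨hu, hv⟩ | ⟨hu, hv⟩)
      · exact sub_nonneg.2 (hu.2.trans hv).le
      · exact sub_nonneg.2 (hu.2.trans hv.1).le)
  rw [setIntegral_prod_snd_sub_fst hU hP, setIntegral_prod_snd_sub_fst hN hV, ← hc_plus,
    ← hc_minus] at hunion
  have hA : μ.real (Set.Ioi 0) * ∫ u in Set.Ioo (-ε) 0, -u ∂μ ≤ ε :=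
    (mul_le_mul_of_nonneg_left (setIntegral_le_of_forall_le measurableSet_Ioo hε.le hU.neg
      fun u hu => neg_le.1 hu.1.le) measureReal_nonneg).trans
      (mul_le_of_le_one_left hε.le measureReal_le_one)
  have hB : μ.real (Set.Ico (-r) 0) * ∫ v in Set.Ioo 0 ε, v ∂μ ≤ ε :=
    (mul_le_mul_of_nonneg_left (setIntegral_le_of_forall_le measurableSet_Ioo hε.le hV
      fun v hv => hv.2.le) measureReal_nonneg).trans
      (mul_le_of_le_one_left hε.le measureReal_le_one)
  have hM : μ.real (Set.Ioo (-ε) 0) + μ.real (Set.Ioo 0 ε) ≤ μ.real (Set.Icc (-ε) ε) := by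
    rw [← measureReal_union (Set.disjoint_left.2 fun x hx hx' => (hx.2.trans hx'.1).false)
      measurableSet_Ioo]
    refine measureReal_mono ?_
    rintro x (hx | hx)
    · exact ⟨hx.1.le, hx.2.le.trans hε.le⟩
    · exact ⟨by linarith [hx.1], hx.2.le⟩
  rw [← measureReal_def, one_div_mul_eq_div, div_le_iff₀ hc_pos, add_mul,
    div_mul_cancel₀ _ hc_pos.ne']
  linarith [mul_le_mul_of_nonneg_right hM hc_pos.le]
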